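/- Let N ∈ {1, 2}, m ≥ 1, let Ψ satisfy condition (K), and let p, q > 0 with either p ≥ 1 or p + q ≥ 2. If u ∈ C^{2m}(ℝ^N) is a non-negative solution of (−Δ)^m u ≥ (Ψ(|·|) * u^p) u^q in ℝ^N, then u ≡ 0. -/

import Mathlib

open MeasureTheory Filter Metric

/-- The Laplacian of `u : ℝ^N → ℝ`, defined via the second iterated Fréchet derivative. -/
noncomputable def lap {N : ℕ} (u : EuclideanSpace ℝ (Fin N) → ℝ) :
    EuclideanSpace ℝ (Fin N) → ℝ :=
  fun x => ∑ i : Fin N,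
    iteratedFDeriv ℝ 2 u x ![EuclideanSpace.single i 1, EuclideanSpace.single i 1]

/-- `negLapPow m u = (-Δ)^m u`, the `m`-fold iterate of the negative Laplacian. -/
noncomputable def negLapPow {N : ℕ} (m : ℕ) (u : EuclideanSpace ℝ (Fin N) → ℝ) :
    EuclideanSpace ℝ (Fin N) → ℝ :=
  (fun v => fun x => -(lap v x))^[m] u

/-- Condition (K) on the kernel `Ψ`. -/
structure CondK (N : ℕ) (Ψ : ℝ → ℝ) : Prop where
  pos : ∀ r : ℝ, 0 < r → 0 < Ψ r
  cont : ContinuousOn (fun x : EuclideanSpace ℝ (Fin N) => Ψ ‖x‖)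
    {(0 : EuclideanSpace ℝ (Fin N))}ᶜ
  locInt : LocallyIntegrable (fun x : EuclideanSpace ℝ (Fin N) => Ψ ‖x‖) volume
  anti : AntitoneOn Ψ (Set.Ioi (0 : ℝ))
  tendsto : Tendsto (fun r : ℝ => r ^ N * Ψ r) atTop atTop

lemma natCast_le_infty (n : ℕ) : (n : WithTop ℕ∞) ≤ ((⊤ : ℕ∞) : WithTop ℕ∞) :=
  WithTop.coe_le_coe.2 le_top

section Laplacian

variable {N : ℕ} {f g : EuclideanSpace ℝ (Fin N) → ℝ}

lemma contDiff_fderiv_apply_of_add_one {n : WithTop ℕ∞} (hf : ContDiff ℝ (n + 1) f)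
    (v : EuclideanSpace ℝ (Fin N)) : ContDiff ℝ n (fun y => fderiv ℝ f y v) :=
  (hf.fderiv_right le_rfl).clm_apply contDiff_const

lemma lap_eq_sum_fderiv (hf : ContDiff ℝ 2 f) (x : EuclideanSpace ℝ (Fin N)) :
    lap f x = ∑ i : Fin N,
      fderiv ℝ (fun y => fderiv ℝ f y (EuclideanSpace.single i 1)) x
        (EuclideanSpace.single i 1) := by
  have hd : DifferentiableAt ℝ (fderiv ℝ f) x :=
    ((hf.fderiv_right (m := 1) (by norm_num)).differentiable (by norm_num)) x
  refine Finset.sum_congr rfl fun i _ => ?_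
  rw [iteratedFDeriv_two_apply, fderiv_clm_apply hd (differentiableAt_const _)]
  simp

lemma ContDiff.lap_of_add_two {n : WithTop ℕ∞} (hf : ContDiff ℝ (n + 2) f) :
    ContDiff ℝ n (lap f) := by
  have h2 : ContDiff ℝ 2 f := hf.of_le le_add_self
  have hf' : ContDiff ℝ (n + 1 + 1) f := by
    rw [add_assoc]; convert hf using 2; norm_num
  rw [funext (lap_eq_sum_fderiv h2)]
  exact ContDiff.sum fun i _ =>
    contDiff_fderiv_apply_of_add_one (contDiff_fderiv_apply_of_add_one hf' _) _

lemma negLapPow_zero (u : EuclideanSpace ℝ (Fin N) → ℝ) : negLapPow 0 u = u := rfl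

lemma negLapPow_succ (m : ℕ) (u : EuclideanSpace ℝ (Fin N) → ℝ) :
    negLapPow (m + 1) u = negLapPow m (fun x => -(lap u x)) :=
  Function.iterate_succ_apply _ _ _

lemma negLapPow_succ_apply (m : ℕ) (u : EuclideanSpace ℝ (Fin N) → ℝ) :
    negLapPow (m + 1) u = fun x => -(lap (negLapPow m u) x) :=
  Function.iterate_succ_apply' _ _ _

lemma ContDiff.negLapPow_of_add {m : ℕ} {n : WithTop ℕ∞} (hf : ContDiff ℝ (n + 2 * m) f) :
    ContDiff ℝ n (negLapPow m f) := by
  induction m generalizing f with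
  | zero => simpa [negLapPow_zero] using hf
  | succ m ih =>
    rw [negLapPow_succ]
    refine ih (ContDiff.neg (ContDiff.lap_of_add_two ?_))
    convert hf using 1
    push_cast
    ring

lemma hasCompactSupport_lap (hf : HasCompactSupport f) : HasCompactSupport (lap f) := by
  refine (hf.iteratedFDeriv 2 (𝕜 := ℝ)).mono ?_
  intro x hx
  contrapose! hx
  have : iteratedFDeriv ℝ 2 f x = 0 := by simpa using hx
  simp [lap, this]

lemma hasCompactSupport_negLapPow (hf : HasCompactSupport f) (m : ℕ) :
    HasCompactSupport (negLapPow m f) := by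
  induction m with
  | zero => exact hf
  | succ m ih =>
    rw [negLapPow_succ_apply]
    exact (hasCompactSupport_lap ih).neg

lemma integral_fderiv_apply_mul (hf : ContDiff ℝ 1 f) (hg : ContDiff ℝ 1 g)
    (hgc : HasCompactSupport g) (v : EuclideanSpace ℝ (Fin N)) :
    ∫ x, fderiv ℝ f x v * g x = -∫ x, f x * fderiv ℝ g x v := by
  have hf' : Continuous fun x => fderiv ℝ f x v :=
    (contDiff_fderiv_apply_of_add_one (n := 0) (by simpa using hf) v).continuous
  have hg' : Continuous fun x => fderiv ℝ g x v :=
    (contDiff_fderiv_apply_of_add_one (n := 0) (by simpa using hg) v).continuous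
  rw [integral_mul_fderiv_eq_neg_fderiv_mul_of_integrable, neg_neg]
  · exact (hf'.mul hg.continuous).integrable_of_hasCompactSupport hgc.mul_left
  · exact (hf.continuous.mul hg').integrable_of_hasCompactSupport
      (hgc.fderiv_apply (𝕜 := ℝ) v).mul_left
  · exact (hf.continuous.mul hg.continuous).integrable_of_hasCompactSupport hgc.mul_left
  · exact fun x _ => (hf.differentiable (by norm_num)) x
  · exact fun x _ => (hg.differentiable (by norm_num)) x

lemma integral_lap_mul (hf : ContDiff ℝ 2 f) (hg : ContDiff ℝ 2 g) (hgc : HasCompactSupport g) :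
    ∫ x, lap f x * g x = ∫ x, f x * lap g x := by
  have hf1 (v) : ContDiff ℝ 1 fun y => fderiv ℝ f y v :=
    contDiff_fderiv_apply_of_add_one (hf.of_le (by norm_num)) v
  have hg1 (v) : ContDiff ℝ 1 fun y => fderiv ℝ g y v :=
    contDiff_fderiv_apply_of_add_one (hg.of_le (by norm_num)) v
  have hf2 (v) : Continuous fun x => fderiv ℝ (fun y => fderiv ℝ f y v) x v :=
    (contDiff_fderiv_apply_of_add_one (n := 0) (by simpa using hf1 v) v).continuous
  have hg2 (v) : Continuous fun x => fderiv ℝ (fun y => fderiv ℝ g y v) x v :=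
    (contDiff_fderiv_apply_of_add_one (n := 0) (by simpa using hg1 v) v).continuous
  have hgc1 (v) : HasCompactSupport fun y => fderiv ℝ g y v := hgc.fderiv_apply (𝕜 := ℝ) v
  simp only [lap_eq_sum_fderiv hf, lap_eq_sum_fderiv hg, Finset.sum_mul, Finset.mul_sum]
  rw [integral_finsetSum, integral_finsetSum]
  · refine Finset.sum_congr rfl fun i _ => ?_
    rw [integral_fderiv_apply_mul (hf1 _) (hg.of_le (by norm_num)) hgc,
      integral_fderiv_apply_mul (hf.of_le (by norm_num)) (hg1 _) (hgc1 _), neg_neg]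
  · exact fun i _ => (hf.continuous.mul (hg2 _)).integrable_of_hasCompactSupport
      ((hgc1 _).fderiv_apply (𝕜 := ℝ) _).mul_left
  · exact fun i _ => ((hf2 _).mul hg.continuous).integrable_of_hasCompactSupport hgc.mul_left

lemma integral_negLapPow_mul {m : ℕ} (hf : ContDiff ℝ (2 * m) f) (hg : ContDiff ℝ (⊤ : ℕ∞) g)
    (hgc : HasCompactSupport g) :
    ∫ x, negLapPow m f x * g x = ∫ x, f x * negLapPow m g x := by
  induction m generalizing f with
  | zero => rfl
  | succ m ih =>
    have h2 : ContDiff ℝ 2 f := hf.of_le (by push_cast; rw [mul_add, mul_one]; exact le_add_self)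
    have hgm : ContDiff ℝ 2 (negLapPow m g) :=
      ContDiff.negLapPow_of_add (hg.of_le (natCast_le_infty _))
    rw [negLapPow_succ, ih, negLapPow_succ_apply]
    · simp only [neg_mul, mul_neg, integral_neg]
      rw [integral_lap_mul h2 hgm (hasCompactSupport_negLapPow hgc m)]
    · refine ContDiff.neg (ContDiff.lap_of_add_two ?_)
      convert hf using 1
      push_cast
      ring

lemma lap_const_mul (hf : ContDiff ℝ 2 f) (c : ℝ) (x : EuclideanSpace ℝ (Fin N)) :
    lap (fun y => c * f y) x = c * lap f x := by
  have : (fun y => c * f y) = c • f := by ext; simp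
  simp only [lap, this, iteratedFDeriv_const_smul_apply hf.contDiffAt, Finset.mul_sum]
  simp

lemma lap_comp_smul (hf : ContDiff ℝ 2 f) (c : ℝ) (x : EuclideanSpace ℝ (Fin N)) :
    lap (fun y => f (c • y)) x = c ^ 2 * lap f (c • x) := by
  simp only [lap, iteratedFDeriv_comp_const_smul c hf, Finset.mul_sum]
  simp

lemma negLapPow_comp_smul (hf : ContDiff ℝ (⊤ : ℕ∞) f) (m : ℕ) (c : ℝ) :
    negLapPow m (fun y => f (c • y)) = fun x => c ^ (2 * m) * negLapPow m f (c • x) := by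
  induction m with
  | zero => simp [negLapPow_zero]
  | succ m ih =>
    have hfm : ContDiff ℝ 2 (negLapPow m f) :=
      ContDiff.negLapPow_of_add (hf.of_le (natCast_le_infty _))
    rw [negLapPow_succ_apply, negLapPow_succ_apply, ih]
    ext x
    rw [lap_const_mul (f := fun y => negLapPow m f (c • y))
      (hfm.comp (contDiff_const_smul c)), lap_comp_smul hfm]
    ring

lemma exists_lap_pow_mul_eq (hf : ContDiff ℝ (⊤ : ℕ∞) f) (hg : ContDiff ℝ (⊤ : ℕ∞) g) (k : ℕ) :
    ∃ h : EuclideanSpace ℝ (Fin N) → ℝ, ContDiff ℝ (⊤ : ℕ∞) h ∧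
      lap (fun x => f x ^ (k + 2) * g x) = fun x => f x ^ k * h x := by
  have key (g : EuclideanSpace ℝ (Fin N) → ℝ) (hg : ContDiff ℝ (⊤ : ℕ∞) g) (k : ℕ)
      (v : EuclideanSpace ℝ (Fin N)) : ∃ h : EuclideanSpace ℝ (Fin N) → ℝ,
      ContDiff ℝ (⊤ : ℕ∞) h ∧
      (fun x => fderiv ℝ (fun y => f y ^ (k + 1) * g y) x v) = fun x => f x ^ k * h x := by
    refine ⟨fun x => f x * fderiv ℝ g x v + (k + 1) * fderiv ℝ f x v * g x, ?_, ?_⟩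
    · have hg' := contDiff_fderiv_apply_of_add_one (n := ((⊤ : ℕ∞) : WithTop ℕ∞)) hg v
      have hf' := contDiff_fderiv_apply_of_add_one (n := ((⊤ : ℕ∞) : WithTop ℕ∞)) hf v
      exact (hf.mul hg').add ((contDiff_const.mul hf').mul hg)
    · ext x
      have hfx : DifferentiableAt ℝ f x := (hf.differentiable (by simp)) x
      have hgx : DifferentiableAt ℝ g x := (hg.differentiable (by simp)) x
      rw [fderiv_fun_mul (hfx.fun_pow _) hgx, fderiv_fun_pow _ hfx]
      simp
      ring
  choose h₁ hh₁ he₁ using fun i : Fin N => key g hg (k + 1) (EuclideanSpace.single i 1)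
  choose h₂ hh₂ he₂ using fun i : Fin N => key (h₁ i) (hh₁ i) k (EuclideanSpace.single i 1)
  refine ⟨fun x => ∑ i, h₂ i x, ContDiff.sum fun i _ => hh₂ i, ?_⟩
  ext x
  have hfg : ContDiff ℝ 2 fun x => f x ^ (k + 2) * g x :=
    ((hf.pow _).mul hg).of_le (natCast_le_infty 2)
  rw [lap_eq_sum_fderiv hfg, Finset.mul_sum]
  refine Finset.sum_congr rfl fun i _ => ?_
  rw [he₁ i]
  exact congrFun (he₂ i) x

lemma exists_negLapPow_pow_eq (hf : ContDiff ℝ (⊤ : ℕ∞) f) (m k : ℕ) :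
    ∃ h : EuclideanSpace ℝ (Fin N) → ℝ, ContDiff ℝ (⊤ : ℕ∞) h ∧
      negLapPow m (fun x => f x ^ (k + 2 * m)) = fun x => f x ^ k * h x := by
  induction m generalizing k with
  | zero => exact ⟨fun _ => 1, contDiff_const, by simp [negLapPow_zero]⟩
  | succ m ih =>
    obtain ⟨h, hh, he⟩ := ih (k + 2)
    obtain ⟨h', hh', he'⟩ := exists_lap_pow_mul_eq hf hh k
    refine ⟨fun x => -h' x, hh'.neg, ?_⟩
    rw [negLapPow_succ_apply, show k + 2 * (m + 1) = k + 2 + 2 * m by ring, he, he']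
    simp

end Laplacian

section NonlocalTerm

variable {N : ℕ} {Ψ : ℝ → ℝ} {p : ℝ} {u : EuclideanSpace ℝ (Fin N) → ℝ}

lemma CondK.locallyIntegrable_comp_norm_sub (hK : CondK N Ψ) (x : EuclideanSpace ℝ (Fin N)) :
    LocallyIntegrable (fun y : EuclideanSpace ℝ (Fin N) => Ψ ‖y - x‖) := by
  refine (locallyIntegrable_map_homeomorph (Homeomorph.subRight x)
    (f := fun z : EuclideanSpace ℝ (Fin N) => Ψ ‖z‖) (μ := volume)).1 ?_
  have : Measure.map (Homeomorph.subRight x) volume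
      = (volume : Measure (EuclideanSpace ℝ (Fin N))) := map_sub_right_eq_self volume x
  rw [this]
  exact hK.locInt

lemma CondK.integrable_rpow_mul (hK : CondK N Ψ) (hp : 0 < p) (hu : Continuous u)
    (hpos : ∀ x, 0 ≤ u x)
    (hint : IntegrableOn (fun y : EuclideanSpace ℝ (Fin N) => u y ^ p * Ψ (‖y‖ / 2))
      {y : EuclideanSpace ℝ (Fin N) | 1 < ‖y‖}) (x : EuclideanSpace ℝ (Fin N)) :
    Integrable fun y => u y ^ p * Ψ ‖y - x‖ := by
  have hup : Continuous fun y => u y ^ p := hu.rpow_const fun _ => Or.inr hp.le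
  have hloc : LocallyIntegrable fun y => u y ^ p * Ψ ‖y - x‖ :=
    (hK.locallyIntegrable_comp_norm_sub x).continuous_mul hup
  set r : ℝ := 2 * ‖x‖ + 1
  have hin : IntegrableOn (fun y => u y ^ p * Ψ ‖y - x‖) (closedBall 0 r) :=
    hloc.integrableOn_isCompact (isCompact_closedBall 0 r)
  have hout : IntegrableOn (fun y => u y ^ p * Ψ ‖y - x‖) (closedBall 0 r)ᶜ := by
    have hsub : (closedBall (0 : EuclideanSpace ℝ (Fin N)) r)ᶜ ⊆ {y | 1 < ‖y‖} := by
      intro y hy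
      have hy' : r < ‖y‖ := by simpa using hy
      have := norm_nonneg x
      simp only [r, Set.mem_ofPred_eq] at hy' ⊢
      linarith
    refine (hint.mono_set hsub).mono' hloc.aestronglyMeasurable.restrict ?_
    refine ae_restrict_of_forall_mem measurableSet_closedBall.compl fun y hy => ?_
    have hy' : r < ‖y‖ := by simpa using hy
    have hx := norm_nonneg x
    have htri : ‖y‖ - ‖x‖ ≤ ‖y - x‖ := norm_sub_norm_le y x
    simp only [r] at hy'
    have h1 : 0 < ‖y‖ / 2 := by linarith
    have h2 : ‖y‖ / 2 ≤ ‖y - x‖ := by linarith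
    have h3 : 0 < ‖y - x‖ := h1.trans_le h2
    rw [Real.norm_of_nonneg (mul_nonneg (Real.rpow_nonneg (hpos y) _) (hK.pos _ h3).le)]
    exact mul_le_mul_of_nonneg_left (hK.anti h1 h3 h2) (Real.rpow_nonneg (hpos y) _)
  rw [← integrableOn_univ, ← Set.union_compl_self (closedBall 0 r)]
  exact hin.union hout

lemma CondK.mul_setIntegral_le_integral [NeZero N] (hK : CondK N Ψ) (hp : 0 < p)
    (hu : Continuous u) (hpos : ∀ x, 0 ≤ u x) {x : EuclideanSpace ℝ (Fin N)}
    (hi : Integrable fun y => u y ^ p * Ψ ‖y - x‖) {ρ : ℝ} (hx : x ∈ closedBall 0 ρ)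
    (hρ : 0 < ρ) :
    Ψ (2 * ρ) * ∫ y in closedBall 0 ρ, u y ^ p ≤ ∫ y, u y ^ p * Ψ ‖y - x‖ := by
  have hup : Continuous fun y => u y ^ p := hu.rpow_const fun _ => Or.inr hp.le
  have hne : ∀ᵐ y : EuclideanSpace ℝ (Fin N), y ≠ x := by
    simp [ae_iff, measure_singleton]
  have hnonneg : 0 ≤ᵐ[volume] fun y => u y ^ p * Ψ ‖y - x‖ := by
    filter_upwards [hne] with y hy
    exact mul_nonneg (Real.rpow_nonneg (hpos y) _)
      (hK.pos _ (norm_pos_iff.2 (sub_ne_zero.2 hy))).le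
  refine le_trans ?_ (setIntegral_le_integral (s := closedBall 0 ρ) hi hnonneg)
  rw [← integral_const_mul]
  refine setIntegral_mono_on_ae ?_ hi.integrableOn measurableSet_closedBall ?_
  · exact (hup.const_mul _).continuousOn.integrableOn_compact (isCompact_closedBall 0 ρ)
  · filter_upwards [hne] with y hy hyρ
    rw [mul_comm]
    refine mul_le_mul_of_nonneg_left ?_ (Real.rpow_nonneg (hpos y) _)
    refine hK.anti (norm_pos_iff.2 (sub_ne_zero.2 hy)) (by simpa using hρ) ?_
    have h1 : ‖y‖ ≤ ρ := by simpa using hyρ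
    have h2 : ‖x‖ ≤ ρ := by simpa using hx
    linarith [norm_sub_le y x]

lemma CondK.tendsto_pow_mul_comp_const_mul (hK : CondK N Ψ) {c : ℝ} (hc : 0 < c) :
    Tendsto (fun r : ℝ => r ^ N * Ψ (c * r)) atTop atTop := by
  have h := (hK.tendsto.comp (tendsto_id.const_mul_atTop hc)).const_mul_atTop
    (inv_pos.2 (pow_pos hc N))
  refine h.congr fun r => ?_
  simp only [Function.comp, id, mul_pow]
  field_simp

end NonlocalTerm

lemma Continuous.setIntegral_closedBall_pos {E : Type*} [NormedAddCommGroup E] [ProperSpace E]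
    [MeasurableSpace E] [BorelSpace E] {μ : Measure E} [IsFiniteMeasureOnCompacts μ]
    [μ.IsOpenPosMeasure] {f : E → ℝ} (hf : Continuous f) (hf0 : ∀ x, 0 ≤ f x) {x : E} {ρ : ℝ}
    (hx : ‖x‖ < ρ) (hfx : 0 < f x) : 0 < ∫ y in closedBall 0 ρ, f y ∂μ := by
  rw [setIntegral_pos_iff_support_of_nonneg_ae (Eventually.of_forall hf0)
    (hf.continuousOn.integrableOn_compact (isCompact_closedBall 0 ρ))]
  refine lt_of_lt_of_le ?_
    (measure_mono (Set.inter_subset_inter_right (Function.support f) ball_subset_closedBall))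
  exact (hf.isOpen_support.inter isOpen_ball).measure_pos μ ⟨x, hfx.ne', by simpa using hx⟩

lemma Real.le_add_rpow_mul_rpow {ε s t : ℝ} (hε : 0 < ε) (hs : 1 ≤ s) (ht : 0 ≤ t) :
    t ≤ ε + ε ^ (1 - s) * t ^ s := by
  rcases le_total t ε with h | h
  · have : 0 ≤ ε ^ (1 - s) * t ^ s :=
      mul_nonneg (Real.rpow_nonneg hε.le _) (Real.rpow_nonneg ht _)
    linarith
  · have ht' : 0 < t := hε.trans_le h
    have h1 : t ^ (1 - s) ≤ ε ^ (1 - s) :=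
      Real.rpow_le_rpow_of_nonpos hε h (by linarith)
    have h2 : t ^ (1 - s) * t ^ s = t := by
      rw [← Real.rpow_add ht']; simp
    have h3 : t ^ (1 - s) * t ^ s ≤ ε ^ (1 - s) * t ^ s :=
      mul_le_mul_of_nonneg_right h1 (Real.rpow_nonneg ht _)
    linarith

section Cutoff

variable {N : ℕ} {u : EuclideanSpace ℝ (Fin N) → ℝ}
  (η : ContDiffBump (0 : EuclideanSpace ℝ (Fin N)))

lemma ContDiffBump.hasCompactSupport_comp_smul_pow {R : ℝ} (hR : R ≠ 0) {k : ℕ} (hk : k ≠ 0) :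
    HasCompactSupport fun x => η (R⁻¹ • x) ^ k :=
  (η.hasCompactSupport.comp_smul (inv_ne_zero hR)).comp_left (g := fun t : ℝ => t ^ k)
    (zero_pow hk)

lemma ContDiffBump.continuous_comp_smul_pow (R : ℝ) (k : ℕ) :
    Continuous fun x => η (R⁻¹ • x) ^ k :=
  (η.continuous.comp (continuous_const_smul R⁻¹)).pow k

lemma exists_integral_negLapPow_mul_cutoff_le {m k : ℕ} (hk : k ≠ 0) (hu : ContDiff ℝ (2 * m) u)
    (hpos : ∀ x, 0 ≤ u x) :
    ∃ C : ℝ, 0 < C ∧ ∀ R : ℝ, 0 < R →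
      ∫ x, negLapPow m u x * η (R⁻¹ • x) ^ (k + 2 * m)
        ≤ C * R⁻¹ ^ (2 * m) * ∫ x, u x * η (R⁻¹ • x) ^ k := by
  have hη : ContDiff ℝ (⊤ : ℕ∞) η := η.contDiff
  obtain ⟨h, hh, he⟩ := exists_negLapPow_pow_eq hη m k
  obtain ⟨C, hC⟩ := η.hasCompactSupport.isCompact.exists_bound_of_continuousOn
    hh.continuous.continuousOn
  have hbound (z) : η z ^ k * h z ≤ max C 1 * η z ^ k := by
    by_cases hz : z ∈ tsupport η
    · rw [mul_comm]
      exact mul_le_mul_of_nonneg_right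
        ((le_abs_self _).trans ((hC z hz).trans (le_max_left _ _))) (pow_nonneg η.nonneg _)
    · simp [image_eq_zero_of_notMem_tsupport hz, hk]
  refine ⟨max C 1, lt_of_lt_of_le one_pos (le_max_right _ _), fun R hR => ?_⟩
  have hsmooth : ContDiff ℝ (⊤ : ℕ∞) fun x => η (R⁻¹ • x) ^ (k + 2 * m) :=
    (hη.comp (contDiff_const_smul R⁻¹)).pow _
  rw [integral_negLapPow_mul hu hsmooth
      (η.hasCompactSupport_comp_smul_pow hR.ne' (by omega)),
    negLapPow_comp_smul (f := fun x => η x ^ (k + 2 * m)) (hη.pow _), he, ← integral_const_mul]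
  have hc := η.hasCompactSupport_comp_smul_pow hR.ne' hk
  refine integral_mono ?_ ?_ fun x => ?_
  · have hcont : Continuous fun x => h (R⁻¹ • x) :=
      hh.continuous.comp (continuous_const_smul R⁻¹)
    exact (hu.continuous.mul (continuous_const.mul
      ((η.continuous_comp_smul_pow R k).mul hcont))).integrable_of_hasCompactSupport
      hc.mul_right.mul_left.mul_left
  · exact ((hu.continuous.mul (η.continuous_comp_smul_pow R k)).integrable_of_hasCompactSupport
      hc.mul_left).const_mul _
  · have h0 : 0 ≤ u x * R⁻¹ ^ (2 * m) := mul_nonneg (hpos x) (by positivity)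
    calc u x * (R⁻¹ ^ (2 * m) * (η (R⁻¹ • x) ^ k * h (R⁻¹ • x)))
        = u x * R⁻¹ ^ (2 * m) * (η (R⁻¹ • x) ^ k * h (R⁻¹ • x)) := by ring
      _ ≤ u x * R⁻¹ ^ (2 * m) * (max C 1 * η (R⁻¹ • x) ^ k) :=
        mul_le_mul_of_nonneg_left (hbound _) h0
      _ = max C 1 * R⁻¹ ^ (2 * m) * (u x * η (R⁻¹ • x) ^ k) := by ring

lemma integral_mul_cutoff_le {k : ℕ} (hk : k ≠ 0) (hu : Continuous u) (hpos : ∀ x, 0 ≤ u x)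
    {ε s R : ℝ} (hε : 0 < ε) (hs : 1 ≤ s) (hR : 0 < R) :
    ∫ x, u x * η (R⁻¹ • x) ^ k ≤
      ε * (volume.real (ball (0 : EuclideanSpace ℝ (Fin N)) 1) * (η.rOut * R) ^ N) +
      ε ^ (1 - s) * ∫ x in closedBall 0 (η.rOut * R), (u x * η (R⁻¹ • x) ^ k) ^ s := by
  have hcont : Continuous fun x => u x * η (R⁻¹ • x) ^ k :=
    hu.mul (η.continuous_comp_smul_pow R k)
  have hcont' : Continuous fun x => ε ^ (1 - s) * (u x * η (R⁻¹ • x) ^ k) ^ s :=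
    (hcont.rpow_const fun _ => Or.inr (by linarith)).const_mul _
  have hK := isCompact_closedBall (0 : EuclideanSpace ℝ (Fin N)) (η.rOut * R)
  have hvol : volume.real (closedBall (0 : EuclideanSpace ℝ (Fin N)) (η.rOut * R))
      = volume.real (ball (0 : EuclideanSpace ℝ (Fin N)) 1) * (η.rOut * R) ^ N := by
    rw [Measure.addHaar_real_closedBall _ _ (mul_pos η.rOut_pos hR).le, mul_comm]
    simp
  rw [← setIntegral_eq_integral_of_forall_compl_eq_zero (s := closedBall 0 (η.rOut * R)),
    ← hvol, mul_comm ε, ← smul_eq_mul (volume.real _), ← setIntegral_const, ← integral_const_mul,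
    ← integral_add]
  · refine setIntegral_mono_on (hcont.continuousOn.integrableOn_compact hK)
      ((continuous_const.add hcont').continuousOn.integrableOn_compact hK)
      measurableSet_closedBall fun x _ => ?_
    exact Real.le_add_rpow_mul_rpow hε hs (mul_nonneg (hpos x) (pow_nonneg η.nonneg _))
  · exact continuous_const.continuousOn.integrableOn_compact hK
  · exact hcont'.continuousOn.integrableOn_compact hK
  · intro x hx
    have hx' : η.rOut * R < ‖x‖ := by simpa using hx
    have : η (R⁻¹ • x) = 0 := by
      apply η.zero_of_le_dist
      rw [dist_zero_right, norm_smul, norm_inv, Real.norm_of_nonneg hR.le, inv_mul_eq_div,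
        le_div_iff₀ hR]
      exact hx'.le
    simp [this, hk]

end Cutoff

theorem stmt_3 (N m : ℕ) (hN : N = 1 ∨ N = 2) (hm : 1 ≤ m)
    (Ψ : ℝ → ℝ) (hK : CondK N Ψ)
    (p q : ℝ) (hp : 0 < p) (hq : 0 < q) (hcond : 1 ≤ p ∨ 2 ≤ p + q)
    (u : EuclideanSpace ℝ (Fin N) → ℝ)
    (hreg : ContDiff ℝ (2 * m) u)
    (hpos : ∀ x, 0 ≤ u x)
    (hint : IntegrableOn (fun y : EuclideanSpace ℝ (Fin N) => u y ^ p * Ψ (‖y‖ / 2))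
      {y : EuclideanSpace ℝ (Fin N) | 1 < ‖y‖})
    (hineq : ∀ x : EuclideanSpace ℝ (Fin N),
      (∫ y : EuclideanSpace ℝ (Fin N), u y ^ p * Ψ ‖y - x‖) * u x ^ q ≤ negLapPow m u x) :
    ∀ x, u x = 0 := by
  have : NeZero N := ⟨by omega⟩
  have hNm : N ≤ 2 * m := by omega
  by_contra! hne
  obtain ⟨x₀, hx₀⟩ := hne
  have hux₀ : 0 < u x₀ := (hpos x₀).lt_of_ne' hx₀
  have hu : Continuous u := hreg.continuous
  have hup : Continuous fun y => u y ^ p := hu.rpow_const fun _ => Or.inr hp.le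
  have hup0 (y) : 0 ≤ u y ^ p := Real.rpow_nonneg (hpos y) _
  have hv : Continuous (negLapPow m u) :=
    (ContDiff.negLapPow_of_add (n := 0) (by simpa using hreg)).continuous
  have hI (x) := hK.integrable_rpow_mul hp hu hpos hint x
  have hlow {x : EuclideanSpace ℝ (Fin N)} {ρ : ℝ} (hx : x ∈ closedBall 0 ρ) (hρ : 0 < ρ) :=
    hK.mul_setIntegral_le_integral hp hu hpos (hI x) hx hρ
  set I : EuclideanSpace ℝ (Fin N) → ℝ := fun x => ∫ y, u y ^ p * Ψ ‖y - x‖ with hIdef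
  set ρ : ℝ := ‖x₀‖ + 1 with hρdef
  have hx₀ρ : ‖x₀‖ < ρ := by simp [hρdef]
  have hρ : 1 ≤ ρ := by simp [hρdef]
  have hA {r : ℝ} (hr : ρ ≤ r) : 0 < ∫ y in closedBall 0 r, u y ^ p :=
    hup.setIntegral_closedBall_pos hup0 (hx₀ρ.trans_le hr) (Real.rpow_pos_of_pos hux₀ _)
  have hIpos (x) : 0 < I x := by
    have hr : 0 < max ρ ‖x‖ := lt_of_lt_of_le (by linarith) (le_max_left _ _)
    exact lt_of_lt_of_le (mul_pos (hK.pos _ (by positivity)) (hA (le_max_left _ _)))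
      (hlow (by simp) hr)
  have hv0 (x) : 0 ≤ negLapPow m u x :=
    (mul_nonneg (hIpos x).le (Real.rpow_nonneg (hpos x) _)).trans (hineq x)
  have hvx₀ : 0 < negLapPow m u x₀ :=
    (mul_pos (hIpos x₀) (Real.rpow_pos_of_pos hux₀ _)).trans_le (hineq x₀)
  set J₀ : ℝ := ∫ y in closedBall 0 ρ, negLapPow m u y with hJ₀
  have hJ₀pos : 0 < J₀ := hv.setIntegral_closedBall_pos hv0 hx₀ρ hvx₀
  let η : ContDiffBump (0 : EuclideanSpace ℝ (Fin N)) := ⟨1, 2, one_pos, one_lt_two⟩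
  obtain ⟨k, hk0, hkq⟩ : ∃ k : ℕ, k ≠ 0 ∧ (1 < q → (k + 2 * m : ℝ) ≤ k * q) := by
    obtain ⟨n, hn⟩ := exists_nat_ge (2 * m / (q - 1) : ℝ)
    refine ⟨n + 1, by omega, fun hq1 => ?_⟩
    rw [div_le_iff₀ (by linarith)] at hn
    push_cast
    nlinarith
  have hK0 : k + 2 * m ≠ 0 := by omega
  set J : ℝ → ℝ := fun R => ∫ x, negLapPow m u x * η (R⁻¹ • x) ^ (k + 2 * m) with hJ
  have hJint {R : ℝ} (hR : 0 < R) :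
      Integrable fun x => negLapPow m u x * η (R⁻¹ • x) ^ (k + 2 * m) :=
    (hv.mul (η.continuous_comp_smul_pow R _)).integrable_of_hasCompactSupport
      (η.hasCompactSupport_comp_smul_pow hR.ne' hK0).mul_left
  have hJge {R : ℝ} (hR : ρ ≤ R) : J₀ ≤ J R := by
    have hR0 : 0 < R := by linarith
    refine le_trans (le_of_eq ?_) (setIntegral_le_integral (s := closedBall 0 ρ) (hJint hR0)
      (Eventually.of_forall fun x => mul_nonneg (hv0 x) (pow_nonneg η.nonneg _)))
    refine setIntegral_congr_fun measurableSet_closedBall fun x hx => ?_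
    have h1 : η (R⁻¹ • x) = 1 := by
      refine η.one_of_mem_closedBall ?_
      have hx' : ‖x‖ ≤ ρ := by simpa using hx
      rw [mem_closedBall_zero_iff, norm_smul, norm_inv, Real.norm_of_nonneg hR0.le,
        inv_mul_eq_div, div_le_iff₀ hR0]
      change ‖x‖ ≤ 1 * R
      linarith
    simp [h1]
  obtain ⟨C, hC, hJle⟩ := exists_integral_negLapPow_mul_cutoff_le η hk0 hreg hpos
  obtain ⟨s, D, hs, hD, hker⟩ : ∃ s D : ℝ, 1 ≤ s ∧ 0 < D ∧ ∀ R, ρ ≤ R →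
      Ψ (4 * R) * ∫ x in closedBall 0 (2 * R), (u x * η (R⁻¹ • x) ^ k) ^ s ≤ D * J R := by
    have hη (s : ℝ) (hs : 0 ≤ s) (R : ℝ) :
        Continuous fun x => (u x * η (R⁻¹ • x) ^ k) ^ s :=
      (hu.mul (η.continuous_comp_smul_pow R k)).rpow_const fun _ => Or.inr hs
    by_cases hp1 : 1 ≤ p
    · refine ⟨p, I 0 / J₀, hp1, div_pos (hIpos 0) hJ₀pos, fun R hR => ?_⟩
      have hR0 : 0 < R := by linarith
      have h1 : ∫ x in closedBall 0 (2 * R), (u x * η (R⁻¹ • x) ^ k) ^ p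
          ≤ ∫ x in closedBall 0 (2 * R), u x ^ p := by
        refine setIntegral_mono_on
          ((hη p hp.le R).continuousOn.integrableOn_compact (isCompact_closedBall _ _))
          (hup.continuousOn.integrableOn_compact (isCompact_closedBall _ _))
          measurableSet_closedBall fun x _ => ?_
        exact Real.rpow_le_rpow (mul_nonneg (hpos x) (pow_nonneg η.nonneg _))
          (mul_le_of_le_one_right (hpos x) (pow_le_one₀ η.nonneg η.le_one)) hp.le
      have h2 := hlow (x := 0) (ρ := 2 * R) (by simp [hR0.le]) (by linarith)
      rw [← mul_assoc, show (2 * 2 : ℝ) = 4 by norm_num] at h2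
      calc _ ≤ Ψ (4 * R) * ∫ x in closedBall 0 (2 * R), u x ^ p :=
            mul_le_mul_of_nonneg_left h1 (hK.pos _ (by linarith)).le
        _ ≤ I 0 := h2
        _ = I 0 / J₀ * J₀ := by field_simp
        _ ≤ I 0 / J₀ * J R :=
            mul_le_mul_of_nonneg_left (hJge hR) (div_pos (hIpos 0) hJ₀pos).le
    · have hq1 : 1 < q := by
        rcases hcond with h | h
        · exact absurd h hp1
        · linarith
      set A : ℝ := ∫ y in closedBall 0 ρ, u y ^ p with hAdef
      have hA0 : 0 < A := hA le_rfl
      refine ⟨q, A⁻¹, hq1.le, inv_pos.2 hA0, fun R hR => ?_⟩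
      have hR0 : 0 < R := by linarith
      have hΨ : 0 < Ψ (4 * R) := hK.pos _ (by linarith)
      rw [inv_mul_eq_div, le_div_iff₀ hA0, mul_right_comm, ← integral_const_mul]
      refine le_trans ?_ (setIntegral_le_integral (s := closedBall 0 (2 * R)) (hJint hR0)
        (Eventually.of_forall fun x => mul_nonneg (hv0 x) (pow_nonneg η.nonneg _)))
      refine setIntegral_mono_on (((hη q hq.le R).const_mul _).continuousOn.integrableOn_compact
        (isCompact_closedBall _ _)) (hJint hR0).integrableOn
        measurableSet_closedBall fun x hx => ?_
      have h1 : Ψ (4 * R) * A ≤ I x := by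
        have h2 := hlow hx (by linarith)
        rw [← mul_assoc, show (2 * 2 : ℝ) = 4 by norm_num] at h2
        refine le_trans (mul_le_mul_of_nonneg_left ?_ hΨ.le) h2
        exact setIntegral_mono_set
          (hup.continuousOn.integrableOn_compact (isCompact_closedBall _ _))
          (Eventually.of_forall hup0)
          (closedBall_subset_closedBall (by linarith)).eventuallyLE
      have h3 : (u x * η (R⁻¹ • x) ^ k) ^ q ≤ u x ^ q * η (R⁻¹ • x) ^ (k + 2 * m) := by
        rw [Real.mul_rpow (hpos x) (pow_nonneg η.nonneg _)]
        refine mul_le_mul_of_nonneg_left ?_ (Real.rpow_nonneg (hpos x) _)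
        rw [← Real.rpow_natCast, ← Real.rpow_mul η.nonneg, ← Real.rpow_natCast]
        refine Real.rpow_le_rpow_of_exponent_ge_of_imp η.nonneg η.le_one ?_ ?_
        · push_cast
          exact hkq hq1
        · intro _ h0
          have : (k : ℝ) ≠ 0 := by exact_mod_cast hk0
          exact absurd h0 (mul_ne_zero this hq.ne')
      calc _ ≤ I x * (u x ^ q * η (R⁻¹ • x) ^ (k + 2 * m)) :=
            mul_le_mul h1 h3 (Real.rpow_nonneg (mul_nonneg (hpos x) (pow_nonneg η.nonneg _)) _)
              (hIpos x).le
        _ = (I x * u x ^ q) * η (R⁻¹ • x) ^ (k + 2 * m) := by ring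
        _ ≤ _ := mul_le_mul_of_nonneg_right (hineq x) (pow_nonneg η.nonneg _)
  set c : ℝ := volume.real (ball (0 : EuclideanSpace ℝ (Fin N)) 1) * 2 ^ N with hc
  have hc0 : 0 ≤ c := by positivity
  set ε : ℝ := J₀ / (4 * (C * (c + 1))) with hε
  have hε0 : 0 < ε := by positivity
  obtain ⟨R, hRρ, hRbig⟩ := ((eventually_ge_atTop ρ).and
    ((hK.tendsto_pow_mul_comp_const_mul (c := 4) (by norm_num)).eventually_ge_atTop
      (4 * C * ε ^ (1 - s) * D))).exists
  have hR1 : 1 ≤ R := hρ.trans hRρ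
  have hR0 : 0 < R := by linarith
  have hΨ : 0 < Ψ (4 * R) := hK.pos _ (by linarith)
  set B : ℝ := ∫ x in closedBall 0 (2 * R), (u x * η (R⁻¹ • x) ^ k) ^ s with hB
  have hJR : 0 < J R := hJ₀pos.trans_le (hJge hRρ)
  have hU := integral_mul_cutoff_le η hk0 hu hpos hε0 hs hR0
  change _ ≤ ε * (volume.real (ball (0 : EuclideanSpace ℝ (Fin N)) 1) * (2 * R) ^ N) +
    ε ^ (1 - s) * B at hU
  rw [mul_pow, ← mul_assoc (volume.real _), ← hc] at hU
  have hpow : R⁻¹ ^ (2 * m) ≤ R⁻¹ ^ N :=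
    pow_le_pow_of_le_one (by positivity) (inv_le_one_of_one_le₀ hR1) hNm
  have hU0 : 0 ≤ ∫ x, u x * η (R⁻¹ • x) ^ k :=
    integral_nonneg fun x => mul_nonneg (hpos x) (pow_nonneg η.nonneg _)
  have hRN : 0 < R ^ N := pow_pos hR0 N
  have h1 : J R * R ^ N ≤ C * (ε * (c * R ^ N) + ε ^ (1 - s) * B) := by
    have h2 : J R ≤ C * R⁻¹ ^ N * ∫ x, u x * η (R⁻¹ • x) ^ k :=
      (hJle R hR0).trans
        (mul_le_mul_of_nonneg_right (mul_le_mul_of_nonneg_left hpow hC.le) hU0)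
    calc J R * R ^ N ≤ (C * R⁻¹ ^ N * ∫ x, u x * η (R⁻¹ • x) ^ k) * R ^ N :=
          mul_le_mul_of_nonneg_right h2 hRN.le
      _ = C * ∫ x, u x * η (R⁻¹ • x) ^ k := by
          rw [inv_pow]; field_simp
      _ ≤ _ := mul_le_mul_of_nonneg_left hU hC.le
  have h3 : C * ε * c ≤ J R / 4 := by
    have h4 : C * ε * (c + 1) = J₀ / 4 := by
      rw [hε]; field_simp
    have h5 : C * ε * c ≤ C * ε * (c + 1) :=
      mul_le_mul_of_nonneg_left (by linarith) (by positivity)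
    linarith [hJge hRρ]
  have h6 : C * ε ^ (1 - s) * B ≤ J R / 4 * R ^ N := by
    have h7 : Ψ (4 * R) * B ≤ D * J R := hker R hRρ
    have h8 : 0 < C * ε ^ (1 - s) := mul_pos hC (Real.rpow_pos_of_pos hε0 _)
    refine le_of_mul_le_mul_right ?_ hΨ
    calc C * ε ^ (1 - s) * B * Ψ (4 * R) = C * ε ^ (1 - s) * (Ψ (4 * R) * B) := by ring
      _ ≤ C * ε ^ (1 - s) * (D * J R) := mul_le_mul_of_nonneg_left h7 h8.le
      _ = 4 * C * ε ^ (1 - s) * D * (J R / 4) := by ring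
      _ ≤ R ^ N * Ψ (4 * R) * (J R / 4) := mul_le_mul_of_nonneg_right hRbig (by positivity)
      _ = J R / 4 * R ^ N * Ψ (4 * R) := by ring
  have h9 : C * ε * c * R ^ N ≤ J R / 4 * R ^ N := mul_le_mul_of_nonneg_right h3 hRN.le
  have h10 : 0 < J R * R ^ N := mul_pos hJR hRN
  linarith
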